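/- For ε > 0 small, let θ = arccos(1 − ε) and let β₀(θ) ∈ (1, ∞) be the unique solution of β₀ cos θ > 1 and arccos(−1/β₀) = (β₀ − cos θ)√(β₀² − 1)/(β₀(β₀ cos θ − 1)). Then there exist constants C > 0 and ε₀ > 0 such that for all ε ∈ (0, ε₀), | β₀(θ) − (1 + ε + (2√2/π)·ε^{3/2}) | ≤ C·ε²; i.e. β₀ = 1 + ε + (2√2/π)ε^{3/2} + O(ε²) as ε → 0⁺. -/

import Mathlib

open Real

theorem le_of_sq_le_sq_aux {x y : ℝ} (hy : 0 ≤ y) (h : x ^ 2 ≤ y ^ 2) : x ≤ y :=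
  abs_le_of_sq_le_sq' h hy |>.2

set_option maxHeartbeats 2000000 in
theorem beta0_taylor_expansion :
    ∃ C > (0 : ℝ), ∃ ε₀ > (0 : ℝ), ∀ ε ∈ Set.Ioo (0 : ℝ) ε₀, ∀ β₀ : ℝ,
      1 < β₀ → 1 < β₀ * (1 - ε) →
      Real.arccos (-1 / β₀)
        = (β₀ - (1 - ε)) * Real.sqrt (β₀ ^ 2 - 1) / (β₀ * (β₀ * (1 - ε) - 1)) →
      |β₀ - (1 + ε + (2 * Real.sqrt 2 / π) * ε ^ ((3 : ℝ) / 2))| ≤ C * ε ^ 2 := by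
  refine ⟨400, by norm_num, 1/100, by norm_num, ?_⟩
  rintro ε ⟨hε0, hε1⟩ β hβ hβε heq
  have hpi := Real.pi_gt_d2
  have hpi2 := Real.pi_lt_d2
  obtain ⟨s, hs0, hs⟩ : ∃ s : ℝ, 0 < s ∧ ε = s ^ 2 :=
    ⟨√ε, Real.sqrt_pos.2 hε0, (Real.sq_sqrt hε0.le).symm⟩
  have hs1 : s < 1/10 := by nlinarith
  have hpow : ε ^ ((3 : ℝ) / 2) = s ^ 3 := by
    rw [hs, ← Real.rpow_natCast s 2, ← Real.rpow_mul hs0.le, ← Real.rpow_natCast s 3]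
    norm_num
  rw [hpow]
  obtain ⟨b, hb⟩ : ∃ b, b = β - 1 := ⟨_, rfl⟩
  obtain rfl : β = 1 + b := by linarith
  have hb0 : 0 < b := by linarith
  obtain ⟨r, hr⟩ : ∃ r, r = √((1 + b) ^ 2 - 1) := ⟨_, rfl⟩
  have hr0 : 0 ≤ r := by rw [hr]; positivity
  have hr2 : r ^ 2 = b * (2 + b) := by
    rw [hr, Real.sq_sqrt (by nlinarith)]; ring
  have hx : -1 / (1 + b) = -(1 / (1 + b)) := by ring
  have hA1 : π / 2 ≤ arccos (-1 / (1 + b)) := by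
    rw [hx, arccos_neg]
    have : arccos (1 / (1 + b)) ≤ π / 2 := arccos_le_pi_div_two.2 (by positivity)
    linarith
  have hA2 : arccos (-1 / (1 + b)) ≤ π := arccos_le_pi _
  have hA3 : π - arccos (-1 / (1 + b)) ≤ π / 2 * r := by
    rw [hx, arccos_neg]
    have h1 : arccos (1 / (1 + b)) ≤ π / 2 := arccos_le_pi_div_two.2 (by positivity)
    have h2 := Real.mul_le_sin (arccos_nonneg (1 / (1 + b))) h1
    rw [sin_arccos] at h2
    have h3 : √(1 - (1 / (1 + b)) ^ 2) ≤ r := by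
      rw [hr]
      apply Real.sqrt_le_sqrt
      have h4 : 1 / (1 + b) * (1 + b) = 1 := by field_simp
      have h5 : 0 < 1 / (1 + b) := by positivity
      set y := 1 / (1 + b)
      nlinarith [sq_nonneg (y - (1 + b)), sq_nonneg (y + (1 + b))]
    have h6 : 2 / π * arccos (1 / (1 + b)) ≤ r := h2.trans h3
    have h7 : arccos (1 / (1 + b)) = π / 2 * (2 / π * arccos (1 / (1 + b))) := by
      field_simp
    have h8 := mul_le_mul_of_nonneg_left h6 (by positivity : 0 ≤ π / 2)
    linarith
  rw [← hr] at heq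
  generalize arccos (-1 / (1 + b)) = A at *
  have hd : 0 < (1 + b) * (1 - ε) - 1 := by linarith
  rw [eq_div_iff (by positivity)] at heq
  subst hs
  obtain ⟨d, hdd⟩ : ∃ d, d = b - s ^ 2 - b * s ^ 2 := ⟨_, rfl⟩
  have hd0 : 0 < d := by rw [hdd]; linarith
  have E : A * (1 + b) * d = (b + s ^ 2) * r := by rw [hdd]; linear_combination heq
  clear heq
  have hbs : s ^ 2 < b := by nlinarith
  have hrb : r ≤ 1 + b := by nlinarith
  have hb5 : b ≤ 5 * s ^ 2 := by
    have h1 : A * d * (1 + b) ≤ (b + s ^ 2) * (1 + b) := by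
      have := mul_le_mul_of_nonneg_left hrb (by positivity : 0 ≤ b + s ^ 2)
      linarith
    have h2 : A * d ≤ b + s ^ 2 := le_of_mul_le_mul_right h1 (by linarith)
    have h3 : 1.57 * d ≤ A * d := mul_le_mul_of_nonneg_right (by linarith) hd0.le
    have h4 : b * s ^ 2 ≤ b * (1/100) := mul_le_mul_of_nonneg_left hε1.le hb0.le
    rw [hdd] at h3 h2
    nlinarith
  have hr4 : r ≤ 4 * s := by
    apply le_of_sq_le_sq_aux <;> nlinarith
  have hs4 : s ^ 4 ≤ s ^ 3 / 10 := by nlinarith [pow_pos hs0 3]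
  have hbs2 : b * s ^ 2 ≤ 5 * s ^ 4 := by nlinarith [pow_pos hs0 2]
  have hbs0 : 0 ≤ b * s ^ 2 := by positivity
  have hdiff : b - s ^ 2 ≤ 17 * s ^ 3 := by
    have h1 : (b + s ^ 2) * r ≤ (6 * s ^ 2) * (4 * s) := by
      apply mul_le_mul <;> first | linarith | positivity
    have h2 : 1.5 * d ≤ A * (1 + b) * d := by
      apply mul_le_mul_of_nonneg_right _ hd0.le
      nlinarith
    rw [hdd] at h2 E
    linarith
  obtain ⟨q, hq⟩ : ∃ q, q = √2 := ⟨_, rfl⟩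
  have hq1 : 1 ≤ q := by rw [hq]; exact Real.one_le_sqrt.2 (by norm_num)
  have hq2 : q ^ 2 = 2 := by rw [hq]; norm_num
  have hrq : q * s ≤ r := by
    apply le_of_sq_le_sq_aux <;> nlinarith
  have hrq2 : r - q * s ≤ 37 * s ^ 2 := by
    have h1 : (r - q * s) * (r + q * s) ≤ 37 * s ^ 3 := by
      have : b ^ 2 ≤ (5 * s ^ 2) ^ 2 := pow_le_pow_left₀ hb0.le hb5 2
      have : (r - q * s) * (r + q * s) = 2 * (b - s ^ 2) + b ^ 2 := by
        linear_combination hr2 - s ^ 2 * hq2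
      nlinarith
    have h2 : (r - q * s) * s ≤ (r - q * s) * (r + q * s) := by
      apply mul_le_mul_of_nonneg_left _ (by linarith)
      nlinarith
    have h3 : (r - q * s) * s ≤ (37 * s ^ 2) * s := by nlinarith
    exact le_of_mul_le_mul_right h3 hs0
  have e1 : |(π - A * (1 + b)) * (b - s ^ 2)| ≤ (10 * s) * (17 * s ^ 3) := by
    rw [abs_mul]
    apply mul_le_mul _ _ (abs_nonneg _) (by positivity)
    · have hAb : A * b ≤ 4 * (5 * s ^ 2) := by
        apply mul_le_mul <;> first | linarith | positivity
      have hAb0 : 0 ≤ A * b := by apply mul_nonneg <;> linarith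
      have hpr : π / 2 * r ≤ 2 * (4 * s) := by
        apply mul_le_mul <;> first | linarith | positivity
      have hss : s ^ 2 ≤ s * (1 / 10) := by rw [sq]; exact mul_le_mul_of_nonneg_left hs1.le hs0.le
      rw [abs_le]; constructor <;> linarith
    · rw [abs_of_nonneg (by linarith)]; exact hdiff
  have e2 : A * (1 + b) * (b * s ^ 2) ≤ 4 * 2 * (5 * s ^ 4) := by
    have : A * (1 + b) ≤ 4 * 2 := by
      apply mul_le_mul <;> nlinarith
    apply mul_le_mul this hbs2 <;> first | linarith | positivity
  have e2' : 0 ≤ A * (1 + b) * (b * s ^ 2) := by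
    apply mul_nonneg (mul_nonneg _ _) hbs0 <;> linarith
  have e3 : (b - s ^ 2) * r ≤ (17 * s ^ 3) * (4 * s) := by
    apply mul_le_mul <;> first | linarith | positivity
  have e3' : 0 ≤ (b - s ^ 2) * r := mul_nonneg (by linarith) hr0
  have e4 : 2 * s ^ 2 * (r - q * s) ≤ 2 * s ^ 2 * (37 * s ^ 2) :=
    mul_le_mul_of_nonneg_left hrq2 (by positivity)
  have e4' : 0 ≤ 2 * s ^ 2 * (r - q * s) := mul_nonneg (by positivity) (by linarith)
  have key : π * (b - s ^ 2) - 2 * q * s ^ 3 =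
      (π - A * (1 + b)) * (b - s ^ 2) + A * (1 + b) * (b * s ^ 2) + (b - s ^ 2) * r
        + 2 * s ^ 2 * (r - q * s) := by
    rw [hdd] at E
    linear_combination E
  rw [abs_le] at e1
  have hs40 : 0 < s ^ 4 := by positivity
  have fin : |π * (b - s ^ 2) - 2 * q * s ^ 3| ≤ 400 * s ^ 4 := by
    rw [key, abs_le]
    constructor <;> linarith
  rw [← hq]
  have : 1 + b - (1 + s ^ 2 + 2 * q / π * s ^ 3) = (π * (b - s ^ 2) - 2 * q * s ^ 3) / π := by
    field_simp
    ring
  rw [this, abs_div, abs_of_pos Real.pi_pos, div_le_iff₀ Real.pi_pos]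
  nlinarith
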